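/- Let N ≥ 2 be even and k ≥ 1. For all integers m, n ≥ 0 with 2(m+n) ≤ N, with the convention that d^{i,j}_N(k,k,k;q,z) = 0 whenever i < 0 or j < 0, the following identity holds in ℚ(q,z): ∑_{i=0}^{1} ∑_{j=0}^{1} d^{2m−i, 2n−j}_N(k,k,k;q,z) = z^{k(m+n)} q^{k(m² + (N+1)n − n²)} / ( ∏_{i=1}^m (1−q^i)(1−q^{−i−m+1}z^{−1}) · ∏_{i=2m+1}^{N−2n} (1−q^i z) · ∏_{i=1}^n (1−q^{−i})(1−q^{−N+i+n−2}z^{−1}) ). -/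

import Mathlib

/-!
STATEMENT 17: for even N ≥ 2, k ≥ 1 and m, n ≥ 0 with 2(m+n) ≤ N, the sum of the
four contributions d^{2m-i,2n-j}_N(k,k,k) (i,j ∈ {0,1}, with the convention that
terms with a negative index vanish) equals the contribution of the glued vertex
(identity in ℚ(q,z)).
-/

open MvPolynomial

noncomputable section

/-- The field `ℚ(q,z)` of rational functions in two variables. -/
abbrev K := FractionRing (MvPolynomial (Fin 2) ℚ)

/-- The variable `q` as an element of `ℚ(q,z)`. -/
def qK : K := algebraMap (MvPolynomial (Fin 2) ℚ) K (X 0)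

/-- The variable `z` as an element of `ℚ(q,z)`. -/
def zK : K := algebraMap (MvPolynomial (Fin 2) ℚ) K (X 1)

def phiQ (N : ℕ) (a : Fin N → ℤ) : ℤ := ∑ t : Fin N, (t.1 + 1 : ℤ) * a t
def phiZ (N : ℕ) (a : Fin N → ℤ) : ℤ := ∑ t : Fin N, a t

/-- The vertex `M_{m,n}` (coordinates 1-indexed in the paper; `j : Fin N`
is the coordinate `j.1 + 1`). -/
def Mvec (N : ℕ) (k l r : ℤ) (m n : ℕ) (j : Fin N) : ℤ :=
  if j.1 + 1 ≤ m then (if (j.1 + 1) % 2 = 1 then l else k - l)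
  else if N - n < j.1 + 1 then (if (N - j.1) % 2 = 1 then r else k - r)
  else 0

/-- The contribution `d^{m,n}_N(k,l,r;q,z)` of the vertex `M_{m,n}`, in `ℚ(q,z)`. -/
def dmn (N : ℕ) (k l r : ℤ) (m n : ℕ) : K :=
  qK ^ phiQ N (Mvec N k l r m n) * zK ^ phiZ N (Mvec N k l r m n) /
    ((∏ i ∈ Finset.Icc 1 (m / 2), (1 - qK ^ (i : ℤ))) *
     (∏ i ∈ Finset.Icc (m / 2 + 1) m, (1 - qK ^ (-(i : ℤ)) * zK⁻¹)) *
     (∏ i ∈ Finset.Icc (m + 1) (N - n), (1 - qK ^ (i : ℤ) * zK)) *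
     (∏ i ∈ Finset.Icc 1 (n / 2), (1 - qK ^ (-(i : ℤ)))) *
     (∏ i ∈ Finset.Icc (n / 2 + 1) n, (1 - qK ^ ((i : ℤ) - N - 1) * zK⁻¹)))

/-- `d^e_N(k,l,r;q,z)`: sum of `d^{m,n}_N` over `m, n ≥ 0` with `m+n < N`, or
`m+n = N` and `m` even. -/
def dE (N : ℕ) (k l r : ℤ) : K :=
  ∑ p ∈ (Finset.range (N + 1) ×ˢ Finset.range (N + 1)).filter
      (fun p => p.1 + p.2 < N ∨ (p.1 + p.2 = N ∧ Even p.1)),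
    dmn N k l r p.1 p.2

/-- `d^o_N(k,l,r;q,z)`: sum of `d^{m,n}_N` over `m, n ≥ 0` with `m+n < N`, or
`m+n = N` and `m` odd. -/
def dO (N : ℕ) (k l r : ℤ) : K :=
  ∑ p ∈ (Finset.range (N + 1) ×ˢ Finset.range (N + 1)).filter
      (fun p => p.1 + p.2 < N ∨ (p.1 + p.2 = N ∧ Odd p.1)),
    dmn N k l r p.1 p.2


/-- `d^{m,n}_N(k,l,r)` for integer indices `m`, `n`, set to `0` when `m < 0` or `n < 0`. -/
def dmnZ (N : ℕ) (k l r : ℤ) (m n : ℤ) : K :=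
  if 0 ≤ m ∧ 0 ≤ n then dmn N k l r m.toNat n.toNat else 0

theorem algebraMap_eval_ne {p r : MvPolynomial (Fin 2) ℚ} (x : Fin 2 → ℚ)
    (hx : eval x p ≠ eval x r) :
    algebraMap (MvPolynomial (Fin 2) ℚ) K p ≠ algebraMap (MvPolynomial (Fin 2) ℚ) K r :=
  fun hpr => hx (congrArg (eval x) (IsFractionRing.injective (MvPolynomial (Fin 2) ℚ) K hpr))

theorem qK_ne_zero : qK ≠ 0 := by
  simp [qK]

theorem zK_ne_zero : zK ≠ 0 := by
  simp [zK]

theorem qK_pow_ne_one {a : ℕ} (ha : a ≠ 0) : qK ^ a ≠ 1 := by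
  have := algebraMap_eval_ne (p := X 0 ^ a) (r := 1) (fun _ => 0) (by simp [ha])
  simpa [qK] using this

theorem qK_zpow_mul_zK_ne_one (a : ℤ) : qK ^ a * zK ≠ 1 := by
  obtain ⟨b, rfl | rfl⟩ := a.eq_nat_or_neg
  · have := algebraMap_eval_ne (p := X 0 ^ b * X 1) (r := 1) ![1, 0] (by simp)
    simpa [qK, zK] using this
  · have := algebraMap_eval_ne (p := X 1) (r := X 0 ^ b) ![1, 0] (by simp)
    intro hb
    rw [zpow_neg, zpow_natCast, inv_mul_eq_one₀ (pow_ne_zero _ qK_ne_zero)] at hb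
    exact this (by simpa [qK, zK] using hb.symm)

/-- The part of the denominator of a vertex contribution coming from one end of the vertex. -/
def endDenom {F : Type*} [Field F] (u v : F) (m : ℕ) : F :=
  (∏ i ∈ Finset.Icc 1 (m / 2), (1 - u ^ (i : ℤ))) *
    ∏ i ∈ Finset.Icc (m / 2 + 1) m, (1 - u ^ (-(i : ℤ)) * v⁻¹)

/-- The factor contributed by one end of length `2 * m - i`, zero if this length is negative,
including the `i` factors gained by the middle product. -/
def endTerm {F : Type*} [Field F] (u v : F) (m i : ℕ) : F :=
  if i ≤ 2 * m then (endDenom u v (2 * m - i) * (1 - u ^ (2 * (m : ℤ)) * v) ^ i)⁻¹ else 0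

theorem inv_add_inv_eq_inv {F : Type*} [Field F] {x w : F} (hw : w ≠ 0) (hx : x ≠ 1)
    (hw1 : w ≠ 1) (hwx : w ≠ x) :
    ((1 - x) * (1 - w⁻¹))⁻¹ + ((1 - x * w⁻¹) * (1 - w))⁻¹ = ((1 - x) * (1 - x * w⁻¹))⁻¹ := by
  have h1 : 1 - x ≠ 0 := sub_ne_zero.2 hx.symm
  have h2 : 1 - w ≠ 0 := sub_ne_zero.2 hw1.symm
  have h3 : w - x ≠ 0 := sub_ne_zero.2 hwx
  have e1 : 1 - w⁻¹ = -(1 - w) / w := by field_simp; ring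
  have e2 : 1 - x * w⁻¹ = (w - x) / w := by field_simp
  rw [e1, e2]
  field_simp
  ring

theorem sum_endTerm {F : Type*} [Field F] {u v : F} (hu : u ≠ 0) (hv : v ≠ 0) (m : ℕ)
    (hum : ∀ a : ℕ, a ≠ 0 → u ^ a ≠ 1) (huv : ∀ a : ℤ, u ^ a * v ≠ 1) :
    ∑ i ∈ Finset.range 2, endTerm u v m i =
      (∏ i ∈ Finset.Icc 1 m, ((1 - u ^ (i : ℤ)) * (1 - u ^ (-(i : ℤ) - m + 1) * v⁻¹)))⁻¹ := by
  obtain _ | m := m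
  · simp [endTerm, endDenom]
  have hshift : ∏ i ∈ Finset.Icc 1 (m + 1),
      (1 - u ^ (-(i : ℤ) - (m + 1 : ℕ) + 1) * v⁻¹) =
      ∏ i ∈ Finset.Icc (m + 1) (2 * m + 1), (1 - u ^ (-(i : ℤ)) * v⁻¹) := by
    refine Finset.prod_bij (fun i _ => i + m) ?_ ?_ ?_ ?_
    · intro i hi; simp only [Finset.mem_Icc] at hi ⊢; omega
    · intro i _ j _ hij; simpa using hij
    · intro j hj; simp only [Finset.mem_Icc] at hj
      exact ⟨j - m, by simp only [Finset.mem_Icc]; omega, by omega⟩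
    · intro i _; congr 3; push_cast; ring
  rw [Finset.prod_mul_distrib, hshift, Finset.sum_range_succ, Finset.sum_range_one]
  unfold endTerm
  rw [if_pos (by omega), if_pos (by omega)]
  unfold endDenom
  rw [show (2 * (m + 1) - 0) / 2 = m + 1 by omega, show 2 * (m + 1) - 0 = 2 * m + 1 + 1 by omega,
    show (2 * (m + 1) - 1) / 2 = m by omega, show 2 * (m + 1) - 1 = 2 * m + 1 by omega,
    Finset.prod_Icc_succ_top (show 1 ≤ m + 1 by omega),
    Finset.prod_Icc_succ_top (show m + 1 + 1 ≤ 2 * m + 1 + 1 by omega),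
    ← Finset.mul_prod_Ioc_eq_prod_Icc (show m + 1 ≤ 2 * m + 1 by omega),
    ← Finset.Icc_add_one_left_eq_Ioc]
  generalize ∏ i ∈ Finset.Icc 1 m, (1 - u ^ (i : ℤ)) = A
  generalize ∏ i ∈ Finset.Icc (m + 1 + 1) (2 * m + 1), (1 - u ^ (-(i : ℤ)) * v⁻¹) = B
  have hmain := inv_add_inv_eq_inv (x := u ^ ((m + 1 : ℕ) : ℤ)) (w := u ^ (2 * ((m + 1 : ℕ) : ℤ)) * v)
    (mul_ne_zero (zpow_ne_zero _ hu) hv) (by rw [zpow_natCast]; exact hum _ (by omega)) (huv _) (by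
      intro he
      apply huv ((m + 1 : ℕ) : ℤ)
      rw [two_mul, zpow_add₀ hu, mul_assoc] at he
      exact mul_left_cancel₀ (zpow_ne_zero ((m + 1 : ℕ) : ℤ) hu) (he.trans (mul_one _).symm))
  have e1 : (u ^ (2 * ((m + 1 : ℕ) : ℤ)) * v)⁻¹ = u ^ (-((2 * m + 1 + 1 : ℕ) : ℤ)) * v⁻¹ := by
    rw [mul_inv, ← zpow_neg]; congr 2
  have e2 : u ^ ((m + 1 : ℕ) : ℤ) * (u ^ (2 * ((m + 1 : ℕ) : ℤ)) * v)⁻¹ =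
      u ^ (-((m + 1 : ℕ) : ℤ)) * v⁻¹ := by
    rw [mul_inv, ← zpow_neg, ← mul_assoc, ← zpow_add₀ hu]; congr 2; ring
  rw [e2, e1] at hmain
  simp only [mul_inv, pow_zero, pow_one, mul_one] at hmain ⊢
  linear_combination (A⁻¹ * B⁻¹) * hmain

theorem sum_ite_even_lt {N m i : ℕ} (hi : i < 2) (h : 2 * m ≤ N) (f : ℕ → ℤ) :
    ∑ t ∈ Finset.range N, (if t < 2 * m - i ∧ t % 2 = 0 then f t else 0) =
      ∑ s ∈ Finset.range m, f (2 * s) := by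
  rw [← Finset.sum_filter]
  symm
  refine Finset.sum_bij (fun s _ => 2 * s) ?_ ?_ ?_ ?_
  · intro s hs; simp only [Finset.mem_filter, Finset.mem_range] at hs ⊢; omega
  · intro s _ t _ hst; simpa using hst
  · intro t ht; simp only [Finset.mem_filter, Finset.mem_range] at ht
    exact ⟨t / 2, by simp only [Finset.mem_range]; omega, by omega⟩
  · intro s _; rfl

theorem sum_mul_Mvec {N m n i j : ℕ} (hi : i < 2) (hj : j < 2) (h : 2 * (m + n) ≤ N) (k : ℤ)
    (f : ℕ → ℤ) :
    ∑ t : Fin N, f t * Mvec N k k k (2 * m - i) (2 * n - j) t =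
      k * (∑ s ∈ Finset.range m, f (2 * s) + ∑ s ∈ Finset.range n, f (N - 1 - 2 * s)) := by
  have hsplit : ∀ t : Fin N, f t * Mvec N k k k (2 * m - i) (2 * n - j) t =
      (fun t : ℕ => k * ((if t < 2 * m - i ∧ t % 2 = 0 then f t else 0) +
        if N - 1 - t < 2 * n - j ∧ (N - 1 - t) % 2 = 0 then f t else 0)) t := by
    rintro ⟨t, ht⟩
    simp only [Mvec, sub_self]
    split_ifs <;> first | omega | ring
  rw [Finset.sum_congr rfl (fun t _ => hsplit t), Fin.sum_univ_eq_sum_range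
    (fun t : ℕ => k * ((if t < 2 * m - i ∧ t % 2 = 0 then f t else 0) +
        if N - 1 - t < 2 * n - j ∧ (N - 1 - t) % 2 = 0 then f t else 0)), ← Finset.mul_sum,
    Finset.sum_add_distrib, sum_ite_even_lt hi (by omega)]
  congr 2
  rw [← Finset.sum_range_reflect, ← sum_ite_even_lt hj (show 2 * n ≤ N by omega)
    (fun t => f (N - 1 - t))]
  refine Finset.sum_congr rfl fun t ht => ?_
  rw [Finset.mem_range] at ht
  rw [show N - 1 - (N - 1 - t) = t by omega]

theorem phiZ_Mvec {N m n i j : ℕ} (hi : i < 2) (hj : j < 2) (h : 2 * (m + n) ≤ N) (k : ℤ) :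
    phiZ N (Mvec N k k k (2 * m - i) (2 * n - j)) = k * (m + n) := by
  simpa [phiZ] using sum_mul_Mvec hi hj h k (fun _ => 1)

theorem phiQ_Mvec {N m n i j : ℕ} (hi : i < 2) (hj : j < 2) (h : 2 * (m + n) ≤ N) (k : ℤ) :
    phiQ N (Mvec N k k k (2 * m - i) (2 * n - j)) =
      k * ((m : ℤ) ^ 2 + ((N : ℤ) + 1) * n - (n : ℤ) ^ 2) := by
  have hm : ∀ m : ℕ, ∑ s ∈ Finset.range m, (((2 * s : ℕ) : ℤ) + 1) = (m : ℤ) ^ 2 := by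
    intro m
    induction m with
    | zero => simp
    | succ m ih => rw [Finset.sum_range_succ, ih]; push_cast; ring
  have hn : ∀ n : ℕ, 2 * n ≤ N → ∑ s ∈ Finset.range n, (((N - 1 - 2 * s : ℕ) : ℤ) + 1) =
      ((N : ℤ) + 1) * n - (n : ℤ) ^ 2 := by
    intro n
    induction n with
    | zero => simp
    | succ n ih =>
      intro hle
      rw [Finset.sum_range_succ, ih (by omega),
        show ((N - 1 - 2 * n : ℕ) : ℤ) = N - 1 - 2 * n by omega]
      push_cast; ring
  rw [phiQ, sum_mul_Mvec hi hj h k (fun t => (t : ℤ) + 1), hm, hn n (by omega)]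
  ring

theorem prod_Icc_extend {M : Type*} [CommMonoid M] {a b i j : ℕ} (hi : i < 2) (hj : j < 2)
    (hia : i ≤ a) (hab : a ≤ b) (f : ℕ → M) :
    ∏ t ∈ Finset.Icc (a - i + 1) (b + j), f t =
      f a ^ i * (∏ t ∈ Finset.Icc (a + 1) b, f t) * f (b + 1) ^ j := by
  have hleft : ∀ c, a ≤ c → ∏ t ∈ Finset.Icc (a - i + 1) c, f t =
      f a ^ i * ∏ t ∈ Finset.Icc (a + 1) c, f t := by
    intro c hc
    interval_cases i
    · simp
    · rw [Nat.sub_add_cancel hia, ← Finset.mul_prod_Ioc_eq_prod_Icc hc,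
        ← Finset.Icc_add_one_left_eq_Ioc, pow_one]
  rw [hleft _ (by omega)]
  interval_cases j
  · simp
  · rw [Finset.prod_Icc_succ_top (by omega), pow_one, mul_assoc]

theorem dmnZ_two_mul_sub {N m n i j : ℕ} (hi : i < 2) (hj : j < 2) (h : 2 * (m + n) ≤ N)
    (k : ℤ) :
    dmnZ N k k k (2 * (m : ℤ) - i) (2 * (n : ℤ) - j) =
      zK ^ (k * ((m : ℤ) + n)) *
        qK ^ (k * ((m : ℤ) ^ 2 + ((N : ℤ) + 1) * n - (n : ℤ) ^ 2)) *
        (∏ i ∈ Finset.Icc (2 * m + 1) (N - 2 * n), (1 - qK ^ (i : ℤ) * zK))⁻¹ *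
        (endTerm qK zK m i * endTerm qK⁻¹ (qK ^ ((N : ℤ) + 1) * zK) n j) := by
  unfold dmnZ
  by_cases him : i ≤ 2 * m
  swap
  · rw [if_neg (by omega)]; simp [endTerm, him]
  by_cases hjn : j ≤ 2 * n
  swap
  · rw [if_neg (by omega)]; simp [endTerm, hjn]
  rw [if_pos (by omega), show (2 * (m : ℤ) - i).toNat = 2 * m - i by omega,
    show (2 * (n : ℤ) - j).toNat = 2 * n - j by omega, dmn, phiQ_Mvec hi hj h, phiZ_Mvec hi hj h,
    show N - (2 * n - j) = N - 2 * n + j by omega,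
    prod_Icc_extend hi hj him (show 2 * m ≤ N - 2 * n by omega)
      (fun t : ℕ => 1 - qK ^ (t : ℤ) * zK), endTerm, endTerm, if_pos him, if_pos hjn, endDenom,
    endDenom]
  have e1 : qK⁻¹ ^ (2 * (n : ℤ)) * (qK ^ ((N : ℤ) + 1) * zK) =
      qK ^ ((N - 2 * n + 1 : ℕ) : ℤ) * zK := by
    rw [inv_zpow', ← mul_assoc, ← zpow_add₀ qK_ne_zero]; congr 2; omega
  have e2 : ∀ t : ℕ, qK⁻¹ ^ (-(t : ℤ)) * (qK ^ ((N : ℤ) + 1) * zK)⁻¹ =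
      qK ^ ((t : ℤ) - N - 1) * zK⁻¹ := by
    intro t
    rw [inv_zpow', mul_inv, ← zpow_neg, ← mul_assoc, ← zpow_add₀ qK_ne_zero]; congr 2; ring
  simp only [e1, e2]
  simp only [inv_zpow', Nat.cast_mul, Nat.cast_ofNat]
  simp only [div_eq_mul_inv, mul_inv]
  ring

theorem glued_vertex_contribution (N : ℕ) (hN : 2 ≤ N) (hNeven : Even N)
    (k : ℤ) (hk : 1 ≤ k) (m n : ℕ) (h : 2 * (m + n) ≤ N) :
    ∑ i ∈ Finset.range 2, ∑ j ∈ Finset.range 2,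
        dmnZ N k k k (2 * (m : ℤ) - i) (2 * (n : ℤ) - j) =
      zK ^ (k * ((m : ℤ) + n)) *
        qK ^ (k * ((m : ℤ) ^ 2 + ((N : ℤ) + 1) * n - (n : ℤ) ^ 2)) /
        ((∏ i ∈ Finset.Icc 1 m,
            ((1 - qK ^ (i : ℤ)) * (1 - qK ^ (-(i : ℤ) - m + 1) * zK⁻¹))) *
         (∏ i ∈ Finset.Icc (2 * m + 1) (N - 2 * n), (1 - qK ^ (i : ℤ) * zK)) *
         (∏ i ∈ Finset.Icc 1 n,
            ((1 - qK ^ (-(i : ℤ))) * (1 - qK ^ (-(N : ℤ) + i + n - 2) * zK⁻¹)))) := by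
  rw [Finset.sum_congr rfl fun i hi => Finset.sum_congr rfl fun j hj =>
    dmnZ_two_mul_sub (Finset.mem_range.1 hi) (Finset.mem_range.1 hj) h k]
  simp only [← Finset.mul_sum, ← Finset.sum_mul]
  rw [sum_endTerm qK_ne_zero zK_ne_zero m (fun a => qK_pow_ne_one)
    qK_zpow_mul_zK_ne_one, sum_endTerm (inv_ne_zero qK_ne_zero)
    (mul_ne_zero (zpow_ne_zero _ qK_ne_zero) zK_ne_zero) n
    (fun a ha => by rw [inv_pow]; exact inv_ne_one.2 (qK_pow_ne_one ha))
    (fun a => by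
      rw [inv_zpow', ← mul_assoc, ← zpow_add₀ qK_ne_zero]
      exact qK_zpow_mul_zK_ne_one _)]
  have e : ∀ t : ℕ, qK⁻¹ ^ (-(t : ℤ) - n + 1) * (qK ^ ((N : ℤ) + 1) * zK)⁻¹ =
      qK ^ (-(N : ℤ) + t + n - 2) * zK⁻¹ := by
    intro t
    rw [inv_zpow', mul_inv, ← zpow_neg, ← mul_assoc, ← zpow_add₀ qK_ne_zero]; congr 2; ring
  simp only [e]
  simp only [inv_zpow']
  simp only [div_eq_mul_inv, mul_inv]
  ring
end
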